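/- arXiv:2512.22835 — 2 statements merged into one kernel-verified Lean document; each statement's English description precedes it below -/
import Mathlib

section
/- Let k > ℓ ≥ 1, p = (k+ℓ)m+2+λ prime with 0 ≤ λ ≤ k+ℓ−5, and n ≥ 2. Let τ ∈ (0,1] be feasible for 1/(k+ℓ), and assume m ≥ 7 and m ≥ 5/τ. Let A ⊆ F_p^n be (k,ℓ)-sum-free with |A| ≥ m·p^{n−1}. Fix a decomposition (v,K) and an enumeration b_1, ..., b_p of F_p with |A_{b_1}| ≥ ... ≥ |A_{b_p}|, set C_m = {b_1, ..., b_m}, and suppose k·|A_{b_m}| ≥ (p+k−1)·p^{n−2}. Then there exists c ∈ F_p ∖ {0} such that either c·C_m is an interval of length m, or c·C_m is contained in a (k,ℓ)-sum-free interval of F_p of length m+1. -/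
open Pointwise

/-- `itSum h A` is the `h`-fold sumset `hA = A + ⋯ + A` (`h` copies), with `itSum 0 A = {0}`. -/
def itSum {G : Type*} [AddCommMonoid G] : ℕ → Set G → Set G
  | 0, _ => {0}
  | h + 1, A => itSum h A + A

/-- `A` is `(k,ℓ)`-sum-free: the sumsets `kA` and `ℓA` are disjoint. -/
def KLFree {G : Type*} [AddCommMonoid G] (k l : ℕ) (A : Set G) : Prop :=
  itSum k A ∩ itSum l A = ∅

/-- The interval `[a, a+t] = {a, a+1, …, a+t}` in `ZMod p`. -/
def Ival {p : ℕ} (a : ZMod p) (t : ℕ) : Set (ZMod p) :=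
  {x | ∃ i : ℕ, i ≤ t ∧ x = a + (i : ZMod p)}

/-- The cuboid `[a, a+t] × F_p^{n'}` inside the model space `F_p × F_p^{n'}`. -/
def cub (p n' : ℕ) (a : ZMod p) (t : ℕ) : Set (ZMod p × (Fin n' → ZMod p)) :=
  {x | x.1 ∈ Ival a t}

/-- The element `a_j = -(km+1+j)·(k-ℓ)⁻¹` of `F_p`. -/
def ajElt (k l m p j : ℕ) : ZMod p :=
  -((k * m + 1 + j : ℕ) : ZMod p) * (((k - l : ℕ) : ZMod p))⁻¹

/-- The layer `A_i = (A - i·v) ∩ K` of `A` w.r.t. the decomposition `(v, K)`. -/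
def layerKL {p n : ℕ} (v : Fin n → ZMod p) (K : Submodule (ZMod p) (Fin n → ZMod p))
    (A : Set (Fin n → ZMod p)) (i : ZMod p) : Set (Fin n → ZMod p) :=
  {x | x ∈ K ∧ x + i • v ∈ A}

/-- The support `Supp(A) = {i | A_i ≠ ∅}` w.r.t. the decomposition `(v, K)`. -/
def supp {p n : ℕ} (v : Fin n → ZMod p) (K : Submodule (ZMod p) (Fin n → ZMod p))
    (A : Set (Fin n → ZMod p)) : Set (ZMod p) :=
  {i | (layerKL v K A i).Nonempty}

/-- The weight `ω(A) = |Supp(A)|` w.r.t. the decomposition `(v, K)`. -/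
noncomputable def weight {p n : ℕ} (v : Fin n → ZMod p)
    (K : Submodule (ZMod p) (Fin n → ZMod p)) (A : Set (Fin n → ZMod p)) : ℕ :=
  (supp v K A).ncard

/-- `A ⊆ F_p^n` is trivial: isomorphic to a subset of some extremal cuboid `A_{k,ℓ,p,j}`. -/
def IsTrivialKL (k l m lam p n : ℕ) (A : Set (Fin n → ZMod p)) : Prop :=
  ∃ (e : (Fin n → ZMod p) ≃+ (ZMod p × (Fin (n - 1) → ZMod p))) (j : ℕ),
    j < (lam + 2) / 2 ∧ e '' A ⊆ cub p (n - 1) (ajElt k l m p j) m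

/-- Type 1. -/
def IsType1 (k l m lam p n : ℕ) (A : Set (Fin n → ZMod p)) : Prop :=
  A.ncard = m * p ^ (n - 1) ∧
  ∃ (e : (Fin n → ZMod p) ≃+ (ZMod p × (Fin (n - 1) → ZMod p))) (a : ZMod p),
    ((l : ZMod p) * a - (k : ZMod p) * (a + (m : ZMod p) - 1) ∈ Ival (1 : ZMod p) (l - 1) ∨
      (lam + l + 2 ≤ k ∧
        (l : ZMod p) * a - (k : ZMod p) * (a + (m : ZMod p) - 1) ∈
          Ival ((lam + l + 2 : ℕ) : ZMod p) (k - (lam + l + 2)))) ∧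
    e '' A = cub p (n - 1) a (m - 1)

/-- The element `a = m·k·(ℓ-k)⁻¹` of `F_p` used in type 2. -/
def type2a (k l m p : ℕ) : ZMod p :=
  (m : ZMod p) * (k : ZMod p) * (((l : ZMod p) - (k : ZMod p))⁻¹)

/-- Type 2. -/
def IsType2 (k l m p n : ℕ) (A : Set (Fin n → ZMod p)) : Prop :=
  l = 1 ∧ 2 ≤ n ∧ A.ncard = m * p ^ (n - 1) ∧
  ∃ (e : (Fin n → ZMod p) ≃+ (ZMod p × (Fin (n - 1) → ZMod p)))
      (V : Submodule (ZMod p) (Fin (n - 1) → ZMod p)),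
    V ≠ ⊤ ∧
    e '' A =
      ({type2a k l m p} ×ˢ (Set.univ \ (V : Set (Fin (n - 1) → ZMod p)))) ∪
        ((Ival (type2a k l m p + 1) (m - 2)) ×ˢ (Set.univ : Set (Fin (n - 1) → ZMod p))) ∪
        ({type2a k l m p + (m : ZMod p)} ×ˢ (V : Set (Fin (n - 1) → ZMod p)))

/-- Normal: of type 1 or type 2. -/
def IsNormalKL (k l m lam p n : ℕ) (A : Set (Fin n → ZMod p)) : Prop :=
  IsType1 k l m lam p n A ∨ IsType2 k l m p n A

/-- The element `a = (ℓm+k-1)·(k-ℓ)⁻¹` of `F_p` used in type 3. -/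
def type3a (k l m p : ℕ) : ZMod p :=
  ((l * m + k - 1 : ℕ) : ZMod p) * (((k - l : ℕ) : ZMod p))⁻¹

/-- Type 3. -/
def IsType3 (k l m p n : ℕ) (A : Set (Fin n → ZMod p)) : Prop :=
  A.ncard = m * p ^ (n - 1) ∧
  ∃ e : (Fin n → ZMod p) ≃+ (ZMod p × (Fin (n - 1) → ZMod p)),
    e '' A = {x | x.1 ∈ Ival (type3a k l m p - 1) (m + 1) \
      {type3a k l m p, type3a k l m p + (m : ZMod p) - 1}}

/-- Type 4 (for `p = 5m+3`). -/
def IsType4 (m p n : ℕ) (A : Set (Fin n → ZMod p)) : Prop :=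
  2 ≤ n ∧ A.ncard = m * p ^ (n - 1) ∧
  ∃ (e : (Fin n → ZMod p) ≃+ (ZMod p × (Fin (n - 1) → ZMod p)))
      (V : Submodule (ZMod p) (Fin (n - 1) → ZMod p)),
    V ≠ ⊤ ∧
    e '' A =
      (({((2 * m + 1 : ℕ) : ZMod p), ((3 * m + 2 : ℕ) : ZMod p)} : Set (ZMod p)) ×ˢ
          (V : Set (Fin (n - 1) → ZMod p))) ∪
        (({((2 * m + 2 : ℕ) : ZMod p), ((3 * m + 1 : ℕ) : ZMod p)} : Set (ZMod p)) ×ˢ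
          (Set.univ \ (V : Set (Fin (n - 1) → ZMod p)))) ∪
        ((Ival ((2 * m + 3 : ℕ) : ZMod p) (m - 3)) ×ˢ (Set.univ : Set (Fin (n - 1) → ZMod p)))

/-- The set `A₀ ⊆ F_p × F_p^s` used in type 5 (for `p = 4m+3`), with `a = (m+2)/2`. -/
def type5A0 (m p s : ℕ) (P : Set (Fin s → ZMod p)) : Set (ZMod p × (Fin s → ZMod p)) :=
  {(((m + 2 : ℕ) : ZMod p) * (2 : ZMod p)⁻¹ - 1, (0 : Fin s → ZMod p))} ∪
    ({((m + 2 : ℕ) : ZMod p) * (2 : ZMod p)⁻¹} ×ˢ (Set.univ \ P)) ∪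
    ((Ival (((m + 2 : ℕ) : ZMod p) * (2 : ZMod p)⁻¹ + 1) (m - 3)) ×ˢ
      (Set.univ : Set (Fin s → ZMod p))) ∪
    ({((m + 2 : ℕ) : ZMod p) * (2 : ZMod p)⁻¹ + (m : ZMod p) - 1} ×ˢ
      (Set.univ \ {(0 : Fin s → ZMod p)})) ∪
    ({((m + 2 : ℕ) : ZMod p) * (2 : ZMod p)⁻¹ + (m : ZMod p)} ×ˢ P)

/-- Type 5 (for `p = 4m+3`). -/
def IsType5 (m p n : ℕ) (A : Set (Fin n → ZMod p)) : Prop :=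
  A.ncard = m * p ^ (n - 1) ∧
  ∃ s : ℕ, s ≤ n - 1 ∧
    ∃ (e : (Fin n → ZMod p) ≃+
          (ZMod p × (Fin s → ZMod p) × (Fin (n - 1 - s) → ZMod p)))
      (P : Set (Fin s → ZMod p)),
      P.Nonempty ∧ (0 : Fin s → ZMod p) ∉ itSum 3 P ∧
      e '' A = {x | (x.1, x.2.1) ∈ type5A0 m p s P}

/-- `τ` is feasible for `c`. -/
def Feasible (c τ : ℝ) : Prop :=
  ∀ q : ℕ, q.Prime → ∀ B : Set (ZMod q),
    (B.ncard : ℝ) ≤ c * q →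
    ((B + B).ncard : ℝ) ≤ (2 + τ) * (B.ncard : ℝ) - 3 →
    ∃ y d : ZMod q, d ≠ 0 ∧
      B ⊆ {x | ∃ i : ℕ, i ≤ (B + B).ncard - B.ncard ∧ x = y + (i : ZMod q) * d}

section SumsetBounds

/-- In a finite abelian group whose proper subgroups have at most `M` elements, two nonempty sets
`A`, `B` satisfy `A + B = G` or `|A| + |B| ≤ |A + B| + M`. -/
theorem add_eq_univ_or_card_add_card_le {G : Type*} [AddCommGroup G] [Finite G] {M : ℕ}
    (hM : ∀ H : AddSubgroup G, H ≠ ⊤ → Nat.card H ≤ M) (A B : Set G) (hA : A.Nonempty)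
    (hB : B.Nonempty) : A + B = Set.univ ∨ A.ncard + B.ncard ≤ (A + B).ncard + M := by
  induction hs : B.ncard using Nat.strong_induction_on generalizing A B with
  | _ s ih =>
    subst hs
    by_cases hex : ∃ e : G, (B ∩ {x | x + e ∈ A}).Nonempty ∧ ¬ B ⊆ {x | x + e ∈ A}
    · obtain ⟨e, hne, hns⟩ := hex
      set B' := B ∩ {x | x + e ∈ A} with hB'
      set A' := A ∪ (fun x => x + e) '' B with hA'
      have hlt : B'.ncard < B.ncard := by
        refine Set.ncard_lt_ncard ⟨Set.inter_subset_left, fun h => hns fun x hx => (h hx).2⟩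
      have himg : (fun x => x + e) '' B' = A ∩ (fun x => x + e) '' B := by
        ext y
        constructor
        · rintro ⟨x, ⟨hx, hxe⟩, rfl⟩
          exact ⟨hxe, x, hx, rfl⟩
        · rintro ⟨hy, x, hx, rfl⟩
          exact ⟨x, ⟨hx, hy⟩, rfl⟩
      have hcard : A'.ncard + B'.ncard = A.ncard + B.ncard := by
        have h1 := Set.ncard_union_add_ncard_inter A ((fun x => x + e) '' B)
        rw [← himg, Set.ncard_image_of_injective _ (add_left_injective e),
          Set.ncard_image_of_injective _ (add_left_injective e)] at h1
        exact h1
      have hsub : A' + B' ⊆ A + B := by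
        rintro _ ⟨x, hx, y, ⟨hy, hye⟩, rfl⟩
        rcases hx with hx | ⟨z, hz, rfl⟩
        · exact Set.add_mem_add hx hy
        · exact ⟨y + e, hye, z, hz, by simp only; abel⟩
      rcases ih _ hlt A' B' (hA.mono Set.subset_union_left) hne rfl with h | h
      · exact Or.inl (Set.univ_subset_iff.mp (h ▸ hsub))
      · have := Set.ncard_le_ncard hsub
        right; omega
    · push Not at hex
      obtain ⟨b₀, hb₀⟩ := hB
      have hstab : ∀ x ∈ A, ∀ y ∈ B, x + (y - b₀) ∈ A := by
        intro x hx y hy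
        have := hex (x - b₀) ⟨b₀, hb₀, by simpa using hx⟩ hy
        simp only [Set.mem_ofPred_eq] at this
        rwa [show x + (y - b₀) = y + (x - b₀) by abel]
      set H := AddSubgroup.closure ((fun y => y - b₀) '' B) with hH
      have hstabH : ∀ h ∈ H, ∀ x ∈ A, x + h ∈ A := by
        intro h hh
        rw [hH, ← AddSubgroup.mem_toAddSubmonoid,
          AddSubgroup.closure_toAddSubmonoid_of_finite] at hh
        induction hh using AddSubmonoid.closure_induction with
        | mem z hz =>
          obtain ⟨y, hy, rfl⟩ := hz
          exact fun x hx => hstab x hx y hy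
        | zero => simp
        | add u w _ _ hu hw => exact fun x hx => by rw [← add_assoc]; exact hw _ (hu _ hx)
      by_cases htop : H = ⊤
      · left
        obtain ⟨x₀, hx₀⟩ := hA
        refine Set.eq_univ_of_forall fun z => ⟨z - b₀, ?_, b₀, hb₀, by simp⟩
        have := hstabH (z - b₀ - x₀) (htop ▸ AddSubgroup.mem_top _) x₀ hx₀
        rwa [add_sub_cancel] at this
      · right
        have h1 : B.ncard ≤ M := by
          refine le_trans ?_ (hM H htop)
          rw [← Set.ncard_image_of_injective B (sub_left_injective (b := b₀))]
          exact Set.ncard_le_ncard AddSubgroup.subset_closure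
        have h2 : A.ncard ≤ (A + B).ncard := by
          rw [← Set.ncard_image_of_injective A (add_left_injective b₀)]
          refine Set.ncard_le_ncard ?_
          rintro _ ⟨x, hx, rfl⟩
          exact Set.add_mem_add hx hb₀
        omega

theorem layers_sumset {p n : ℕ} [Fact p.Prime] {M β : ℕ} (v : Fin n → ZMod p)
    (K : Submodule (ZMod p) (Fin n → ZMod p)) (hM : ∀ H : AddSubgroup K, H ≠ ⊤ → Nat.card H ≤ M)
    (A : Set (Fin n → ZMod p)) (C : Set (ZMod p)) (hβ : 0 < β)
    (hC : ∀ i ∈ C, β ≤ (layerKL v K A i).ncard) (h : ℕ) :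
    ∀ z ∈ itSum (h + 1) C, ∃ P : Set K, P.Nonempty ∧
      (∀ x ∈ P, (x : Fin n → ZMod p) + z • v ∈ itSum (h + 1) A) ∧
      (P = Set.univ ∨ (h + 1) * β ≤ P.ncard + h * M) := by
  have hlayer : ∀ i ∈ C, β ≤ {x : K | (x : Fin n → ZMod p) + i • v ∈ A}.ncard := by
    intro i hi
    have himg : (fun x : K => (x : Fin n → ZMod p)) '' {x : K | (x : Fin n → ZMod p) + i • v ∈ A}
        = layerKL v K A i := by
      ext x
      constructor
      · rintro ⟨y, hy, rfl⟩
        exact ⟨y.2, hy⟩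
      · rintro ⟨hx, hxA⟩
        exact ⟨⟨x, hx⟩, hxA, rfl⟩
    rw [← Set.ncard_image_of_injective _ Subtype.val_injective, himg]
    exact hC i hi
  have hne : ∀ i ∈ C, {x : K | (x : Fin n → ZMod p) + i • v ∈ A}.Nonempty := fun i hi =>
    Set.nonempty_of_ncard_ne_zero (by have := hlayer i hi; omega)
  induction h with
  | zero =>
    intro z hz
    have hz : z ∈ C := by simpa [itSum] using hz
    exact ⟨_, hne z hz, fun x hx => by simpa [itSum] using hx, Or.inr (by simpa using hlayer z hz)⟩
  | succ h ih =>
    rintro _ ⟨z, hz, i, hi, rfl⟩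
    obtain ⟨P, hPne, hPA, hP⟩ := ih z hz
    refine ⟨P + {x : K | (x : Fin n → ZMod p) + i • v ∈ A}, hPne.add (hne i hi), ?_, ?_⟩
    · rintro _ ⟨x, hx, y, hy, rfl⟩
      refine ⟨_, hPA x hx, _, hy, ?_⟩
      simp only [Submodule.coe_add, add_smul]
      abel
    · rcases hP with rfl | hP
      · left
        obtain ⟨y, hy⟩ := hne i hi
        exact Set.eq_univ_of_forall fun x => ⟨x - y, Set.mem_univ _, y, hy, by simp⟩
      · refine (add_eq_univ_or_card_add_card_le hM _ _ hPne (hne i hi)).imp_right fun h' => ?_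
        have := hlayer i hi
        rw [add_mul (h + 1) 1 β, add_mul h 1 M]
        omega

theorem ncard_itSum_ge {p m : ℕ} (hp : p.Prime) {C : Set (ZMod p)} (hm : 0 < m)
    (hC : C.ncard = m) (h2 : 2 * m + 3 ≤ (C + C).ncard) (h : ℕ) :
    min p ((h + 1) * m + h) ≤ (itSum (h + 1) C).ncard := by
  classical
  have : Fact p.Prime := ⟨hp⟩
  have cd : ∀ X Y : Set (ZMod p), X.Nonempty → Y.Nonempty →
      min p (X.ncard + Y.ncard - 1) ≤ (X + Y).ncard := by
    intro X Y hX hY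
    have := ZMod.cauchy_davenport hp (s := X.toFinite.toFinset) (t := Y.toFinite.toFinset)
      (by simpa using hX) (by simpa using hY)
    rwa [← Set.ncard_coe_finset, ← Set.ncard_coe_finset, ← Set.ncard_coe_finset, Finset.coe_add,
      Set.Finite.coe_toFinset, Set.Finite.coe_toFinset] at this
  induction h using Nat.strong_induction_on with
  | _ h ih =>
    match h, ih with
    | 0, _ => simp [itSum, hC]
    | 1, _ => simp only [itSum, Set.singleton_add, zero_add, Set.image_id']; omega
    | h + 2, ih =>
      have hh := ih h (by omega)
      have e : itSum (h + 2 + 1) C = itSum (h + 1) C + (C + C) := by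
        rw [← add_assoc]; rfl
      rw [e]
      have hp0 := hp.pos
      have hpos : 0 < (h + 1) * m := by positivity
      have := cd (itSum (h + 1) C) (C + C) (Set.nonempty_of_ncard_ne_zero (by omega))
        (Set.nonempty_of_ncard_ne_zero (by omega))
      have e2 : (h + 2 + 1) * m = (h + 1) * m + 2 * m := by ring
      omega

theorem itSum_smul {p : ℕ} (c : ZMod p) (C : Set (ZMod p)) (h : ℕ) :
    itSum h (c • C) = c • itSum h C := by
  induction h with
  | zero => simp [itSum]
  | succ h ih => rw [itSum, itSum, ih, smul_add]

theorem KLFree.smul {p k l : ℕ} [Fact p.Prime] {C : Set (ZMod p)} (hC : KLFree k l C)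
    {c : ZMod p} (hc : c ≠ 0) : KLFree k l (c • C) := by
  unfold KLFree at *
  rw [itSum_smul, itSum_smul, ← Set.smul_set_inter₀ hc, hC, Set.smul_set_empty]

theorem itSum_image_add_cast {p : ℕ} (a : ZMod p) (T : Set ℕ) (h : ℕ) {i : ℕ}
    (hi : i ∈ itSum h T) : h * a + i ∈ itSum h ((fun i : ℕ => a + (i : ZMod p)) '' T) := by
  induction h generalizing i with
  | zero =>
    obtain rfl : i = 0 := hi
    simp [itSum]
  | succ h ih =>
    obtain ⟨u, hu, w, hw, rfl⟩ := hi
    exact ⟨_, ih hu, _, ⟨w, hw, rfl⟩, by push_cast; ring⟩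

theorem exists_of_mem_itSum_Ival {p : ℕ} (a : ZMod p) (t h : ℕ) {z : ZMod p}
    (hz : z ∈ itSum h (Ival a t)) : ∃ i ≤ h * t, z = h * a + (i : ℕ) := by
  induction h generalizing z with
  | zero =>
    obtain rfl : z = 0 := hz
    exact ⟨0, by simp⟩
  | succ h ih =>
    obtain ⟨u, hu, _, ⟨j, hj, rfl⟩, rfl⟩ := hz
    obtain ⟨i, hi, rfl⟩ := ih hu
    exact ⟨i + j, by rw [add_mul, one_mul]; omega, by push_cast; ring⟩

end SumsetBounds

section IntegerSumsets

theorem mem_itSum_succ {T : Set ℕ} {h i t n : ℕ} (hi : i ∈ itSum h T) (ht : t ∈ T)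
    (hn : n = i + t) : n ∈ itSum (h + 1) T :=
  hn ▸ Set.add_mem_add hi ht

theorem mem_itSum_one {T : Set ℕ} {n : ℕ} : n ∈ itSum 1 T ↔ n ∈ T := by simp [itSum]

theorem mem_itSum_two {T : Set ℕ} {i t n : ℕ} (hi : i ∈ T) (ht : t ∈ T) (hn : n = i + t) :
    n ∈ itSum 2 T :=
  mem_itSum_succ (mem_itSum_one.mpr hi) ht hn

theorem mem_itSum_of_second_missing {T : Set ℕ} {m : ℕ} (hm : 3 ≤ m)
    (hT : ∀ i ≤ m, i ≠ 1 → i ∈ T) (h : ℕ) :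
    ∀ n ≤ (h + 1) * m, n ≠ 1 → n ∈ itSum (h + 1) T := by
  induction h with
  | zero => exact fun n hn h1 => mem_itSum_one.mpr (hT n (by omega) h1)
  | succ h ih =>
    intro n hn h1
    have e : (h + 1 + 1) * m = (h + 1) * m + m := by ring
    have e' : (h + 1) * m = h * m + m := by ring
    by_cases hle : n ≤ (h + 1) * m
    · exact mem_itSum_succ (ih n hle h1) (hT 0 (by omega) (by omega)) rfl
    by_cases h2 : n - m = 1
    · exact mem_itSum_succ (ih (n - (m - 1)) (by omega) (by omega)) (hT (m - 1) (by omega)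
        (by omega)) (by omega)
    · exact mem_itSum_succ (ih (n - m) (by omega) h2) (hT m (by omega) (by omega)) (by omega)

theorem mem_itSum_of_penultimate_missing {T : Set ℕ} {m : ℕ} (hm : 3 ≤ m)
    (hT : ∀ i ≤ m, i ≠ m - 1 → i ∈ T) (h : ℕ) :
    ∀ n ≤ (h + 1) * m, n ≠ (h + 1) * m - 1 → n ∈ itSum (h + 1) T := by
  induction h with
  | zero => exact fun n hn h1 => mem_itSum_one.mpr (hT n (by omega) (by simpa using h1))
  | succ h ih =>
    intro n hn h1
    have e : (h + 1 + 1) * m = (h + 1) * m + m := by ring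
    have e' : (h + 1) * m = h * m + m := by ring
    by_cases hle : m ≤ n
    · exact mem_itSum_succ (ih (n - m) (by omega) (by omega)) (hT m (by omega) (by omega))
        (by omega)
    by_cases h2 : n = (h + 1) * m - 1
    · exact mem_itSum_succ (ih (n - 1) (by omega) (by omega)) (hT 1 (by omega) (by omega))
        (by omega)
    · exact mem_itSum_succ (ih n (by omega) h2) (hT 0 (by omega) (by omega)) rfl

theorem mem_itSum_of_inner_missing {T : Set ℕ} {m x : ℕ} (hx : 2 ≤ x) (hxm : x + 2 ≤ m)
    (hT : ∀ i ≤ m, i ≠ x → i ∈ T) (h : ℕ) :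
    ∀ n ≤ (h + 2) * m, n ∈ itSum (h + 2) T := by
  induction h with
  | zero =>
    intro n hn
    by_cases h1 : n = x
    · exact mem_itSum_two (hT 1 (by omega) (by omega)) (hT (x - 1) (by omega) (by omega))
        (by omega)
    by_cases h2 : n ≤ m
    · exact mem_itSum_two (hT n h2 h1) (hT 0 (by omega) (by omega)) rfl
    by_cases h3 : n - m = x
    · exact mem_itSum_two (hT (x + 1) (by omega) (by omega)) (hT (m - 1) (by omega) (by omega))
        (by omega)
    · exact mem_itSum_two (hT (n - m) (by omega) h3) (hT m (by omega) (by omega)) (by omega)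
  | succ h ih =>
    intro n hn
    have e : (h + 1 + 2) * m = (h + 2) * m + m := by ring
    have e' : (h + 2) * m = h * m + 2 * m := by ring
    by_cases hle : n ≤ (h + 2) * m
    · exact mem_itSum_succ (ih n hle) (hT 0 (by omega) (by omega)) rfl
    · exact mem_itSum_succ (ih (n - m) (by omega)) (hT m (by omega) (by omega)) (by omega)

/-- Any pair from the `k`- and `ℓ`-fold sums of an interval can be translated into the `k`- and
`ℓ`-fold sums of that interval with one inner point removed. -/
theorem exists_shift_of_one_hole {T : Set ℕ} {m x k l i j : ℕ} (hm : 7 ≤ m) (hk : 1 < k)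
    (hl : 1 ≤ l) (hx0 : 0 < x) (hxm : x < m) (hT : ∀ i ≤ m, i ≠ x → i ∈ T) (hi : i ≤ k * m)
    (hj : j ≤ l * m) :
    ∃ i' ∈ itSum k T, ∃ j' ∈ itSum l T, i' + j = i + j' := by
  obtain ⟨k, rfl⟩ : ∃ k', k = k' + 2 := ⟨k - 2, by omega⟩
  obtain ⟨l, rfl⟩ : ∃ l', l = l' + 1 := ⟨l - 1, by omega⟩
  have ek : (k + 2) * m = k * m + 2 * m := by ring
  have el : (l + 1) * m = l * m + m := by ring
  by_cases hx1 : x = 1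
  · subst hx1
    have hkT := mem_itSum_of_second_missing (by omega) hT (k + 1)
    have hlT := mem_itSum_of_second_missing (by omega) hT l
    have ek' : (k + 1 + 1) * m = (k + 2) * m := by ring
    rw [ek'] at hkT
    suffices ∃ i' j', i' ≤ (k + 2) * m ∧ i' ≠ 1 ∧ j' ≤ (l + 1) * m ∧ j' ≠ 1 ∧ i' + j = i + j' by
      obtain ⟨i', j', h1, h2, h3, h4, h5⟩ := this
      exact ⟨i', hkT i' h1 h2, j', hlT j' h3 h4, h5⟩
    by_cases h0 : i ≠ 1 ∧ j ≠ 1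
    · exact ⟨i, j, by omega⟩
    by_cases h1 : i ≠ 0 ∧ j ≠ 0 ∧ i < (k + 2) * m ∧ j < (l + 1) * m
    · exact ⟨i + 1, j + 1, by omega⟩
    by_cases h2 : i = 0 ∨ j = 0
    · exact ⟨i + 2, j + 2, by omega⟩
    · exact ⟨i - 1, j - 1, by omega⟩
  by_cases hx2 : x = m - 1
  · subst hx2
    have hkT := mem_itSum_of_penultimate_missing (by omega) hT (k + 1)
    have hlT := mem_itSum_of_penultimate_missing (by omega) hT l
    have ek' : (k + 1 + 1) * m = (k + 2) * m := by ring
    rw [ek'] at hkT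
    suffices ∃ i' j', i' ≤ (k + 2) * m ∧ i' ≠ (k + 2) * m - 1 ∧ j' ≤ (l + 1) * m ∧
        j' ≠ (l + 1) * m - 1 ∧ i' + j = i + j' by
      obtain ⟨i', j', h1, h2, h3, h4, h5⟩ := this
      exact ⟨i', hkT i' h1 h2, j', hlT j' h3 h4, h5⟩
    by_cases h0 : i ≠ (k + 2) * m - 1 ∧ j ≠ (l + 1) * m - 1
    · exact ⟨i, j, by omega⟩
    by_cases h1 : i ≠ 0 ∧ j ≠ 0 ∧ i < (k + 2) * m ∧ j < (l + 1) * m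
    · exact ⟨i - 1, j - 1, by omega⟩
    by_cases h2 : i = 0 ∨ j = 0
    · exact ⟨i + 1, j + 1, by omega⟩
    · exact ⟨i - 2, j - 2, by omega⟩
  have hkT := mem_itSum_of_inner_missing (by omega) (by omega) hT k
  obtain _ | l := l
  · by_cases h0 : j = x
    · by_cases h1 : i = 0
      · exact ⟨i + 1, hkT _ (by omega), j + 1,
          mem_itSum_one.mpr (hT _ (by omega) (by omega)), by omega⟩
      · exact ⟨i - 1, hkT _ (by omega), j - 1,
          mem_itSum_one.mpr (hT _ (by omega) (by omega)), by omega⟩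
    · exact ⟨i, hkT i hi, j, mem_itSum_one.mpr (hT j (by omega) h0), rfl⟩
  · exact ⟨i, hkT i hi, j, mem_itSum_of_inner_missing (by omega) (by omega) hT l j hj, rfl⟩

/-- An integer set which hits at most one point of each pair `{i, s - i}` of an interval
contains at most about half of that interval. -/
theorem two_mul_card_filter_le (T : Finset ℕ) (u w s : ℕ) (hs : s = u + w)
    (hT : ∀ i ∈ T, ∀ j ∈ T, i + j ≠ s) :
    2 * (T.filter fun i => u ≤ i ∧ i ≤ w).card ≤ w + 1 - u := by
  have hinj : Set.InjOn (fun i => s - i) (T.filter fun i => u ≤ i ∧ i ≤ w : Finset ℕ) := by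
    intro i hi j hj hij
    simp only [Finset.coe_filter, Set.mem_ofPred_eq] at hi hj hij
    omega
  have hdisj : Disjoint (T.filter fun i => u ≤ i ∧ i ≤ w)
      ((T.filter fun i => u ≤ i ∧ i ≤ w).image fun i => s - i) := by
    rw [Finset.disjoint_left]
    intro i hi hi'
    obtain ⟨j, hj, rfl⟩ := Finset.mem_image.mp hi'
    rw [Finset.mem_filter] at hi hj
    exact hT _ hi.1 j hj.1 (by omega)
  have hsub : (T.filter fun i => u ≤ i ∧ i ≤ w) ∪
      ((T.filter fun i => u ≤ i ∧ i ≤ w).image fun i => s - i) ⊆ Finset.Icc u w := by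
    intro i hi
    rw [Finset.mem_Icc]
    rcases Finset.mem_union.mp hi with hi | hi
    · rw [Finset.mem_filter] at hi
      exact hi.2
    · obtain ⟨j, hj, rfl⟩ := Finset.mem_image.mp hi
      rw [Finset.mem_filter] at hj
      omega
  have := Finset.card_le_card hsub
  rw [Finset.card_union_of_disjoint hdisj, Finset.card_image_of_injOn hinj, Nat.card_Icc] at this
  omega

/-- If a dense integer set `T ⊆ [0, N]` with `0, N ∈ T` has `g` holes, then its iterated sumsets
have at most `g` holes. -/
theorem exists_holes_itSum {T : Finset ℕ} {N : ℕ} (hTN : ∀ i ∈ T, i ≤ N) (h0 : 0 ∈ T)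
    (hN : N ∈ T) (hcard : N + 2 < 2 * T.card) (q : ℕ) :
    ∃ H : Finset ℕ, H.card + T.card ≤ N + 1 ∧
      ∀ n ≤ (q + 1) * N, n ∉ H → n ∈ itSum (q + 1) (T : Set ℕ) := by
  classical
  set I := Finset.range (N + 1)
  have hTI : T ⊆ I := fun i hi => Finset.mem_range.mpr (by have := hTN i hi; omega)
  have hIT : (I \ T).card + T.card ≤ N + 1 := by
    rw [Finset.card_sdiff_add_card_eq_card hTI, Finset.card_range]
  obtain _ | q := q
  · refine ⟨I \ T, hIT, fun n hn hnT => mem_itSum_one.mpr ?_⟩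
    by_contra h
    exact hnT (Finset.mem_sdiff.mpr ⟨Finset.mem_range.mpr (by omega), h⟩)
  set L := I.filter fun r => r ∉ itSum 2 (T : Set ℕ) with hL
  set R := I.filter fun r => r + N ∉ itSum 2 (T : Set ℕ) with hR
  have hdisj : ∀ r, r ∈ L → r ∈ R → False := by
    intro r hrL hrR
    simp only [hL, hR, I, Finset.mem_filter, Finset.mem_range] at hrL hrR
    have h1 := two_mul_card_filter_le T 0 r r (by omega)
      fun i hi j hj hij => hrL.2 (mem_itSum_two hi hj hij.symm)
    have h2 := two_mul_card_filter_le T r N (r + N) rfl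
      fun i hi j hj hij => hrR.2 (mem_itSum_two hi hj hij.symm)
    have hsub : T ⊆ (T.filter fun i => 0 ≤ i ∧ i ≤ r) ∪ (T.filter fun i => r ≤ i ∧ i ≤ N) := by
      intro i hi
      have := hTN i hi
      simp only [Finset.mem_union, Finset.mem_filter, hi, true_and]
      omega
    have h3 := (Finset.card_le_card hsub).trans (Finset.card_union_le _ _)
    omega
  have hNL : N ∉ L := fun h => (Finset.mem_filter.mp h).2 (mem_itSum_two hN h0 rfl)
  have h0R : 0 ∉ R := fun h => (Finset.mem_filter.mp h).2 (mem_itSum_two h0 hN rfl)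
  have hLR : (L ∪ R).card ≤ (I \ T).card := by
    refine Finset.card_le_card fun r hr => ?_
    rw [Finset.mem_sdiff]
    rcases Finset.mem_union.mp hr with hr | hr
    · exact ⟨(Finset.mem_filter.mp hr).1, fun h =>
        (Finset.mem_filter.mp hr).2 (mem_itSum_two h h0 rfl)⟩
    · exact ⟨(Finset.mem_filter.mp hr).1, fun h =>
        (Finset.mem_filter.mp hr).2 (mem_itSum_two h hN rfl)⟩
  rw [Finset.card_union_of_disjoint (Finset.disjoint_left.mpr fun r h h' => hdisj r h h')] at hLR
  refine ⟨L ∪ R.image fun r => (q + 1) * N + r, ?_, ?_⟩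
  · have h1 := Finset.card_union_le L (R.image fun r => (q + 1) * N + r)
    have h2 := Finset.card_image_le (s := R) (f := fun r => (q + 1) * N + r)
    omega
  suffices ∀ n ≤ (q + 2) * N, n ∉ itSum (q + 2) (T : Set ℕ) →
      n ∈ L ∨ ∃ r ∈ R, (q + 1) * N + r = n by
    intro n hn hnH
    by_contra hc
    refine hnH (Finset.mem_union.mpr ((this n hn hc).imp_right fun h => ?_))
    exact Finset.mem_image.mpr h
  have hRle : ∀ r ∈ R, r ≤ N := fun r hr => by
    have := Finset.mem_range.mp (Finset.mem_filter.mp hr).1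
    omega
  have hLle : ∀ r ∈ L, r ≤ N := fun r hr => by
    have := Finset.mem_range.mp (Finset.mem_filter.mp hr).1
    omega
  induction q with
  | zero =>
    intro n hn hnT
    by_cases hle : n ≤ N
    · exact Or.inl (Finset.mem_filter.mpr ⟨Finset.mem_range.mpr (by omega), hnT⟩)
    · refine Or.inr ⟨n - N, Finset.mem_filter.mpr ⟨Finset.mem_range.mpr (by omega), ?_⟩, by omega⟩
      rwa [Nat.sub_add_cancel (by omega)]
  | succ q ih =>
    intro n hn hnT
    have e1 : (q + 1 + 2) * N = (q + 2) * N + N := by ring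
    have e2 : (q + 2) * N = (q + 1) * N + N := by ring
    have e3 : (q + 1) * N = q * N + N := by ring
    have e4 : (q + 1 + 1) * N = (q + 1) * N + N := by ring
    by_cases hlt : n < N
    · rcases ih n (by omega) fun h => hnT (mem_itSum_succ h h0 rfl) with h | ⟨r, hr, h⟩
      · exact Or.inl h
      · omega
    rcases ih (n - N) (by omega) fun h => hnT (mem_itSum_succ h hN (by omega)) with h | ⟨r, hr, h⟩
    · exfalso
      have h5 := hLle _ h
      rcases ih n (by omega) fun h => hnT (mem_itSum_succ h h0 rfl) with h' | ⟨r, hr, h'⟩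
      · have h6 := hLle _ h'
        exact hNL (by rwa [show n = N by omega] at h')
      · obtain _ | q := q
        · exact hdisj (n - N) h (by rwa [show n - N = r by omega])
        · have e5 : (q + 1) * N = q * N + N := by ring
          exact h0R (by rwa [show r = 0 by omega] at hr)
    · exact Or.inr ⟨r, hr, by omega⟩

end IntegerSumsets

section Structure

theorem min_le_ncard_of_holes {p : ℕ} [Fact p.Prime] (a : ZMod p) {X : Set (ZMod p)} {Q : ℕ}
    (H : Finset ℕ) (hX : ∀ n ≤ Q, n ∉ H → a + (n : ZMod p) ∈ X) :
    min p (Q + 1) ≤ X.ncard + H.card := by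
  classical
  set J := Finset.range (min p (Q + 1))
  have hinj : Set.InjOn (fun n : ℕ => a + (n : ZMod p)) (J \ H : Finset ℕ) := by
    intro i hi j hj hij
    simp only [J, Finset.coe_sdiff, Set.mem_sdiff, Finset.mem_coe, Finset.mem_range] at hi hj
    have h := (ZMod.natCast_eq_natCast_iff' i j p).mp (add_left_cancel hij)
    rwa [Nat.mod_eq_of_lt (by omega), Nat.mod_eq_of_lt (by omega)] at h
  have h1 : (J \ H).card ≤ X.ncard := by
    rw [← Set.ncard_coe_finset, ← hinj.ncard_image]
    refine Set.ncard_le_ncard ?_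
    rintro _ ⟨n, hn, rfl⟩
    simp only [J, Finset.coe_sdiff, Set.mem_sdiff, Finset.mem_coe, Finset.mem_range] at hn
    exact hX n (by omega) hn.2
  have h2 := Finset.le_card_sdiff H J
  rw [Finset.card_range] at h2
  omega

theorem ncard_itSum_add_ncard_itSum_le {p k l : ℕ} [Fact p.Prime] {C : Set (ZMod p)}
    (hC : KLFree k l C) : (itSum k C).ncard + (itSum l C).ncard ≤ p := by
  rw [← Set.ncard_union_eq (Set.disjoint_iff_inter_eq_empty.mpr hC)]
  have := Set.ncard_le_ncard (Set.subset_univ (itSum k C ∪ itSum l C))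
  rwa [Set.ncard_univ, Nat.card_zmod] at this

theorem ncard_add_self_le_of_KLFree {p k l m lam : ℕ} [Fact p.Prime] {C : Set (ZMod p)}
    (hk : 0 < k) (hl : 0 < l) (hlam : lam + 5 ≤ k + l) (hp : p = (k + l) * m + 2 + lam)
    (hm : 0 < m) (hC : C.ncard = m) (hfree : KLFree k l C) : (C + C).ncard ≤ 2 * m + 2 := by
  by_contra! h
  have hpp : p.Prime := Fact.out
  obtain ⟨k, rfl⟩ : ∃ k', k = k' + 1 := ⟨k - 1, by omega⟩
  obtain ⟨l, rfl⟩ : ∃ l', l = l' + 1 := ⟨l - 1, by omega⟩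
  have h1 := ncard_itSum_ge hpp hm hC (by omega) k
  have h2 := ncard_itSum_ge hpp hm hC (by omega) l
  have h3 := ncard_itSum_add_ncard_itSum_le hfree
  have h4 : 0 < (k + 1) * m := by positivity
  have h5 : 0 < (l + 1) * m := by positivity
  have h6 := hpp.pos
  have h7 : (k + 1 + (l + 1)) * m = (k + 1) * m + (l + 1) * m := by ring
  omega

/-- The structure of a `(k,ℓ)`-sum-free set lying in a short interval. -/
theorem KLFree.interval_or_subset_interval {p k l m lam N : ℕ} [Fact p.Prime] (hlk : l < k)
    (hl : 1 ≤ l) (hlam : lam + 5 ≤ k + l) (hp : p = (k + l) * m + 2 + lam) (hm : 7 ≤ m)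
    (a : ZMod p) (T : Finset ℕ) (hTm : T.card = m) (hTN : ∀ i ∈ T, i ≤ N) (h0 : 0 ∈ T)
    (hN : N ∈ T) (hNm : N ≤ m + 2)
    (hfree : KLFree k l ((fun i : ℕ => a + (i : ZMod p)) '' (T : Set ℕ))) :
    (fun i : ℕ => a + (i : ZMod p)) '' (T : Set ℕ) = Ival a (m - 1) ∨
      (KLFree k l (Ival a m) ∧ (fun i : ℕ => a + (i : ZMod p)) '' (T : Set ℕ) ⊆ Ival a m) := by
  classical
  have hTI : T ⊆ Finset.range (N + 1) := fun i hi => Finset.mem_range.mpr (by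
    have := hTN i hi; omega)
  have hmN : m ≤ N + 1 := by simpa [hTm] using Finset.card_le_card hTI
  obtain rfl | rfl | hN2 : N = m - 1 ∨ N = m ∨ m + 1 ≤ N := by omega
  · left
    have hT : T = Finset.range (m - 1 + 1) :=
      Finset.eq_of_subset_of_card_le hTI (by rw [Finset.card_range]; omega)
    ext z
    constructor
    · rintro ⟨i, hi, rfl⟩
      exact ⟨i, hTN i hi, rfl⟩
    · rintro ⟨i, hi, rfl⟩
      exact ⟨i, by rw [hT]; simpa using by omega, rfl⟩
  · right
    refine ⟨?_, ?_⟩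
    · obtain ⟨x, hx⟩ : ∃ x, Finset.range (N + 1) \ T = {x} := by
        rw [← Finset.card_eq_one]
        have := Finset.card_sdiff_add_card_eq_card hTI
        rw [Finset.card_range] at this
        omega
      have hxT : x ∉ T ∧ x ≤ N := by
        have : x ∈ Finset.range (N + 1) \ T := by rw [hx]; exact Finset.mem_singleton_self x
        rw [Finset.mem_sdiff, Finset.mem_range] at this
        exact ⟨this.2, by omega⟩
      have hT : ∀ i ≤ N, i ≠ x → i ∈ (T : Set ℕ) := by
        intro i hi hix
        by_contra hiT
        refine hix (Finset.mem_singleton.mp ?_)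
        rw [← hx, Finset.mem_sdiff, Finset.mem_range]
        exact ⟨by omega, hiT⟩
      have hx0 : x ≠ 0 := fun h => hxT.1 (h ▸ h0)
      have hxN : x ≠ N := fun h => hxT.1 (h ▸ hN)
      refine Set.eq_empty_of_forall_notMem fun z hz => ?_
      obtain ⟨i, hi, rfl⟩ := exists_of_mem_itSum_Ival a N k hz.1
      obtain ⟨j, hj, hij⟩ := exists_of_mem_itSum_Ival a N l hz.2
      obtain ⟨i', hi', j', hj', h⟩ := exists_shift_of_one_hole hm (by omega) hl (by omega)
        (by omega) hT hi hj
      have hi'' := itSum_image_add_cast a _ k hi'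
      have hj'' := itSum_image_add_cast a _ l hj'
      have heq : (k : ZMod p) * a + i' = l * a + j' := by
        have : (i' : ZMod p) + j = i + j' := by exact_mod_cast congrArg (Nat.cast (R := ZMod p)) h
        linear_combination this + hij
      exact Set.eq_empty_iff_forall_notMem.mp hfree _ ⟨hi'', heq ▸ hj''⟩
    · rintro _ ⟨i, hi, rfl⟩
      exact ⟨i, hTN i hi, rfl⟩
  · exfalso
    obtain ⟨k, rfl⟩ : ∃ k', k = k' + 1 := ⟨k - 1, by omega⟩
    obtain ⟨l, rfl⟩ : ∃ l', l = l' + 1 := ⟨l - 1, by omega⟩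
    have key : ∀ q, ∃ g, g + m ≤ N + 1 ∧ min p ((q + 1) * N + 1) ≤
        (itSum (q + 1) ((fun i : ℕ => a + (i : ZMod p)) '' (T : Set ℕ))).ncard + g := by
      intro q
      obtain ⟨H, hH, hHq⟩ := exists_holes_itSum hTN h0 hN (by omega) q
      exact ⟨H.card, by omega, min_le_ncard_of_holes (((q + 1 : ℕ) : ZMod p) * a) H
        fun n hn hnH => itSum_image_add_cast a _ (q + 1) (hHq n hn hnH)⟩
    obtain ⟨g, hg, hgk⟩ := key k
    obtain ⟨g', hg', hgl⟩ := key l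
    have h3 := ncard_itSum_add_ncard_itSum_le hfree
    obtain ⟨d, rfl⟩ : ∃ d, N = m + d := ⟨N - m, by omega⟩
    have e1 : (k + 1 + (l + 1)) * m = k * m + l * m + 2 * m := by ring
    have e2 : (k + 1) * (m + d) = k * m + m + k * d + d := by ring
    have e3 : (l + 1) * (m + d) = l * m + m + l * d + d := by ring
    obtain rfl | rfl : d = 1 ∨ d = 2 := by omega
    all_goals omega

theorem KLFree.dilate_interval_or_subset_interval {p k l m lam : ℕ} [Fact p.Prime] (hlk : l < k)
    (hl : 1 ≤ l) (hlam : lam + 5 ≤ k + l) (hp : p = (k + l) * m + 2 + lam) (hm : 7 ≤ m)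
    {C : Set (ZMod p)} (hC : C.ncard = m) (hfree : KLFree k l C) {y d : ZMod p} (hd : d ≠ 0)
    (hCd : ∀ x ∈ C, ∃ i : ℕ, i ≤ m + 2 ∧ x = y + (i : ZMod p) * d) :
    ∃ c : ZMod p, c ≠ 0 ∧ ((∃ a : ZMod p, c • C = Ival a (m - 1)) ∨
      (∃ a : ZMod p, KLFree k l (Ival a m) ∧ c • C ⊆ Ival a m)) := by
  classical
  have hpm : m + 2 < p := by
    have : 3 * m ≤ (k + l) * m := Nat.mul_le_mul_right m (by omega)
    omega
  set S := (Finset.range (m + 3)).filter fun i : ℕ => y + (i : ZMod p) * d ∈ C with hS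
  have hinj : Set.InjOn (fun i : ℕ => y + (i : ZMod p) * d) (S : Set ℕ) := by
    intro i hi j hj hij
    simp only [hS, Finset.mem_coe, Finset.mem_filter, Finset.mem_range] at hi hj
    have h := (ZMod.natCast_eq_natCast_iff' i j p).mp (mul_right_cancel₀ hd (add_left_cancel hij))
    rwa [Nat.mod_eq_of_lt (by omega), Nat.mod_eq_of_lt (by omega)] at h
  have himg : (fun i : ℕ => y + (i : ZMod p) * d) '' (S : Set ℕ) = C := by
    ext x
    constructor
    · rintro ⟨i, hi, rfl⟩
      exact (Finset.mem_filter.mp hi).2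
    · intro hx
      obtain ⟨i, hi, rfl⟩ := hCd x hx
      exact ⟨i, Finset.mem_filter.mpr ⟨Finset.mem_range.mpr (by omega), hx⟩, rfl⟩
  have hScard : S.card = m := by
    rw [← Set.ncard_coe_finset, ← hinj.ncard_image, himg, hC]
  have hSne : S.Nonempty := Finset.card_pos.mp (by omega)
  set u := S.min' hSne
  have hu : ∀ i ∈ S, u ≤ i := fun i hi => S.min'_le i hi
  have huS : u ∈ S := S.min'_mem hSne
  set w := S.max' hSne
  have hw : ∀ i ∈ S, i ≤ w := fun i hi => S.le_max' i hi
  have hwS : w ∈ S := S.max'_mem hSne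
  have hw2 : w ≤ m + 2 := by
    have := Finset.mem_range.mp (Finset.mem_filter.mp hwS).1
    omega
  set T := S.image fun i => i - u with hT
  have hTcard : T.card = m := by
    rw [hT, Finset.card_image_of_injOn, hScard]
    intro i hi j hj hij
    have := hu i hi
    have := hu j hj
    simp only at hij
    omega
  have hmulC : d⁻¹ • C = (fun i : ℕ => d⁻¹ * y + u + (i : ZMod p)) '' (T : Set ℕ) := by
    rw [← himg, hT, Finset.coe_image, Set.image_image, ← Set.image_smul, Set.image_image]
    refine Set.image_congr fun i hi => ?_
    rw [Nat.cast_sub (hu i hi), smul_eq_mul]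
    field_simp
    ring
  refine ⟨d⁻¹, inv_ne_zero hd, ?_⟩
  have hfree' := hfree.smul (inv_ne_zero hd)
  rw [hmulC] at hfree' ⊢
  refine (KLFree.interval_or_subset_interval hlk hl hlam hp hm (d⁻¹ * y + u) T hTcard (N := w - u)
    ?_ ?_ ?_ (by omega) hfree').imp (fun h => ⟨_, h⟩) fun h => ⟨_, h⟩
  · intro j hj
    obtain ⟨i, hi, rfl⟩ := Finset.mem_image.mp hj
    have := hw i hi
    omega
  · exact Finset.mem_image.mpr ⟨u, huS, by simp⟩
  · exact Finset.mem_image.mpr ⟨w, hwS, rfl⟩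

/-- If the layers of a `(k,ℓ)`-sum-free set over `C` are large, then `C` is `(k,ℓ)`-sum-free. -/
theorem KLFree.of_layers {p n k l : ℕ} [Fact p.Prime] (hk : 0 < k) (hl : 0 < l) (hn : 2 ≤ n)
    {A : Set (Fin n → ZMod p)} (hfree : KLFree k l A) (v : Fin n → ZMod p)
    (K : Submodule (ZMod p) (Fin n → ZMod p)) (hK : Module.finrank (ZMod p) K = n - 1)
    (C : Set (ZMod p)) (β : ℕ) (hC : ∀ i ∈ C, β ≤ (layerKL v K A i).ncard)
    (hβ : (p + k - 1) * p ^ (n - 2) ≤ k * β) : KLFree k l C := by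
  have hpp : p.Prime := Fact.out
  obtain ⟨k, rfl⟩ : ∃ k', k = k' + 1 := ⟨k - 1, by omega⟩
  obtain ⟨l, rfl⟩ : ∃ l', l = l' + 1 := ⟨l - 1, by omega⟩
  obtain ⟨n, rfl⟩ : ∃ n', n = n' + 2 := ⟨n - 2, by omega⟩
  have hKcard : Nat.card K = p ^ (n + 1) := by
    rw [Module.natCard_eq_pow_finrank (K := ZMod p), hK, Nat.card_zmod]
    rfl
  simp only [Nat.add_sub_cancel, ← add_assoc] at hβ
  have hppos := hpp.pos
  have hM0 : 0 < p ^ n := by positivity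
  have hβ0 : 0 < β := by
    rcases Nat.eq_zero_or_pos β with h | h
    · subst h
      have : 0 < (p + k) * p ^ n := by positivity
      omega
    · exact h
  have hM : ∀ H : AddSubgroup K, H ≠ ⊤ → Nat.card H ≤ p ^ n := by
    intro H hH
    have hdvd := H.card_addSubgroup_dvd_card
    rw [hKcard, Nat.dvd_prime_pow hpp] at hdvd
    obtain ⟨e, he, hHe⟩ := hdvd
    have : e ≠ n + 1 := by
      rintro rfl
      exact hH ((AddSubgroup.card_eq_iff_eq_top H).mp (hHe.trans hKcard.symm))
    rw [hHe]
    exact Nat.pow_le_pow_right hppos (by omega)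
  refine Set.eq_empty_of_forall_notMem fun z hz => ?_
  obtain ⟨P, -, hPA, hP⟩ := layers_sumset v K hM A C hβ0 hC k z hz.1
  obtain ⟨P', ⟨x, hx⟩, hPA', -⟩ := layers_sumset v K hM A C hβ0 hC l z hz.2
  have hPuniv : P = Set.univ := by
    refine hP.elim id fun hP => Set.eq_of_subset_of_ncard_le (Set.subset_univ _) ?_
    rw [Set.ncard_univ, hKcard]
    have e1 : (p + k) * p ^ n = p ^ (n + 1) + k * p ^ n := by ring
    omega
  exact Set.eq_empty_iff_forall_notMem.mp hfree _
    ⟨hPA x (hPuniv ▸ Set.mem_univ x), hPA' x hx⟩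

end Structure

/-- Under the same hypotheses as Statement 10, plus `λ ≤ k+ℓ-5`,
`m ≥ 7` and `m ≥ 5/τ` with `τ` feasible for `1/(k+ℓ)`, the set `C_m` is, up to
multiplication by a nonzero scalar, an interval of length `m` or contained in a
`(k,ℓ)`-sum-free interval of length `m+1`. -/
theorem stmt11 (k l n m lam p : ℕ) (τ : ℝ) (hlk : l < k) (hl : 1 ≤ l) (hn : 2 ≤ n)
    (hlam : (lam : ℤ) ≤ (k : ℤ) + l - 5)
    (hp : p = (k + l) * m + 2 + lam) (hpp : p.Prime)
    (hτ0 : 0 < τ) (hτ1 : τ ≤ 1) (hfeas : Feasible (1 / (k + l : ℝ)) τ)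
    (hm7 : 7 ≤ m) (hm1 : 5 / τ ≤ (m : ℝ))
    (A : Set (Fin n → ZMod p)) (hA : A.Nonempty) (hfree : KLFree k l A)
    (hcard : m * p ^ (n - 1) ≤ A.ncard)
    (v : Fin n → ZMod p) (K : Submodule (ZMod p) (Fin n → ZMod p))
    (hK : Module.finrank (ZMod p) K = n - 1) (hv : v ∉ K)
    (b : ℕ → ZMod p) (hb : Set.BijOn b (Set.Icc 1 p) Set.univ)
    (hmono : ∀ i j : ℕ, 1 ≤ i → i ≤ j → j ≤ p →
      (layerKL v K A (b j)).ncard ≤ (layerKL v K A (b i)).ncard)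
    (hbeta : (p + k - 1) * p ^ (n - 2) ≤ k * (layerKL v K A (b m)).ncard) :
    ∃ c : ZMod p, c ≠ 0 ∧
      ((∃ a : ZMod p, c • (b '' Set.Icc 1 m) = Ival a (m - 1)) ∨
        (∃ a : ZMod p, KLFree k l (Ival a m) ∧ c • (b '' Set.Icc 1 m) ⊆ Ival a m)) := by
  have : Fact p.Prime := ⟨hpp⟩
  have hmp : m ≤ p := by
    have : 1 * m ≤ (k + l) * m := Nat.mul_le_mul_right m (by omega)
    omega
  have hCm : (b '' Set.Icc 1 m).ncard = m := by
    rw [(hb.injOn.mono (Set.Icc_subset_Icc_right hmp)).ncard_image,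
      ← Finset.coe_Icc, Set.ncard_coe_finset, Nat.card_Icc, Nat.add_sub_cancel]
  have hCfree : KLFree k l (b '' Set.Icc 1 m) := by
    refine hfree.of_layers (by omega) hl hn v K hK _ _ ?_ hbeta
    rintro _ ⟨i, hi, rfl⟩
    exact hmono i m hi.1 hi.2 hmp
  have h2C := ncard_add_self_le_of_KLFree (by omega) hl (by omega) hp (by omega) hCm hCfree
  obtain ⟨y, d, hd, hCd⟩ := hfeas p hpp (b '' Set.Icc 1 m) (by
    rw [hCm, hp]
    have hkl : (0 : ℝ) < k + l := by
      have : 0 < k + l := by omega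
      exact_mod_cast this
    rw [one_div, inv_mul_eq_div, le_div_iff₀ hkl]
    push_cast
    have := Nat.cast_nonneg (α := ℝ) lam
    linarith) (by
    rw [hCm]
    have h5 : 5 ≤ m * τ := (div_le_iff₀ hτ0).mp hm1
    have : ((b '' Set.Icc 1 m + b '' Set.Icc 1 m).ncard : ℝ) ≤ 2 * m + 2 := by exact_mod_cast h2C
    linarith)
  refine hCfree.dilate_interval_or_subset_interval hlk hl (by omega) hp hm7 hCm (y := y) hd
    fun x hx => ?_
  obtain ⟨i, hi, hx⟩ := hCd hx
  exact ⟨i, by omega, hx⟩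
end

section
/- Let k > ℓ ≥ 1, p = (k+ℓ)m+2+λ prime with 0 ≤ λ ≤ k+ℓ−3, m ≥ 4, and n ≥ 2. Let A ⊆ F_p^n be (k,ℓ)-sum-free. Fix a decomposition (v,K) and an enumeration b_1, ..., b_p of F_p with |A_{b_1}| ≥ ... ≥ |A_{b_p}|, and suppose ω(A) ≥ m+2. Suppose r_1, ..., r_k, s_1, ..., s_ℓ are integers in {m−1, m, ..., ω(A)} such that both the value m−1 and the value m occur at least once among r_1, ..., r_k, s_1, ..., s_ℓ. If r_1 + ... + r_k + s_1 + ... + s_ℓ ≥ p + k + ℓ − 2, then |A_{b_{r_1}}| + ... + |A_{b_{r_k}}| + |A_{b_{s_1}}| + ... + |A_{b_{s_ℓ}}| ≤ (p+k+ℓ−2)·p^{n−2}. -/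
open Pointwise

section Sumsets

variable {G : Type*} [AddCommGroup G] [Fintype G] [DecidableEq G]

/-- A weak form of Kneser's theorem: if `s + t` is not the whole group, then
`|s| + |t| ≤ |s + t| + N`, where `N` bounds the order of every proper subgroup. -/
theorem card_add_card_le_card_add {N : ℕ} (hN : ∀ H : AddSubgroup G, H ≠ ⊤ → Nat.card H ≤ N)
    {s t : Finset G} (hs : s.Nonempty) (ht : t.Nonempty) (hst : s + t ≠ Finset.univ) :
    s.card + t.card ≤ (s + t).card + N := by
  induction hc : t.card using Nat.strong_induction_on generalizing s t with
  | _ c ih =>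
    by_cases h : ∃ a ∈ s, ∃ b ∈ t, ∃ d ∈ t, (a - b) + d ∉ s
    · obtain ⟨a, ha, b, hb, d, hd, had⟩ := h
      set x := Finset.addDysonETransform (a - b) (s, t) with hx
      have hsub : x.1 + x.2 ⊆ s + t := Finset.addDysonETransform.subset (a - b) (s, t)
      have hcard : x.1.card + x.2.card = s.card + t.card :=
        Finset.addDysonETransform.card (a - b) (s, t)
      have hx1 : x.1 = s ∪ ((a - b) +ᵥ t) := rfl
      have hx2 : x.2 = t ∩ (-(a - b) +ᵥ s) := rfl
      have hlt : x.2.card < c := by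
        rw [← hc]
        refine Finset.card_lt_card ⟨hx2 ▸ Finset.inter_subset_left, fun hsup => had ?_⟩
        have := hsup hd
        rw [hx2, Finset.mem_inter, Finset.mem_neg_vadd_finset_iff] at this
        exact this.2
      have hne1 : x.1.Nonempty := ⟨a, by rw [hx1]; exact Finset.mem_union_left _ ha⟩
      have hne2 : x.2.Nonempty := by
        refine ⟨b, ?_⟩
        rw [hx2, Finset.mem_inter, Finset.mem_neg_vadd_finset_iff]
        exact ⟨hb, by simpa using ha⟩
      have huniv : x.1 + x.2 ≠ Finset.univ := fun h =>
        hst (Finset.univ_subset_iff.mp (h ▸ hsub))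
      have := ih _ hlt hne1 hne2 huniv rfl
      have := Finset.card_le_card hsub
      omega
    · push Not at h
      obtain ⟨b, hb⟩ := ht
      have hsu : s ≠ Finset.univ := by
        rintro rfl
        refine hst (Finset.eq_univ_of_forall fun y => ?_)
        exact Finset.mem_add.mpr ⟨y - b, Finset.mem_univ _, b, hb, by simp⟩
      set H := AddAction.stabilizer G s with hH
      have hHtop : H ≠ ⊤ := by
        intro htop
        obtain ⟨a, ha⟩ := hs
        refine hsu (Finset.eq_univ_of_forall fun y => ?_)
        have hmem : y - a ∈ H := by rw [htop]; trivial
        rw [hH, AddAction.mem_stabilizer_iff] at hmem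
        rw [← hmem]
        exact Finset.mem_vadd_finset.mpr ⟨a, ha, by simp⟩
      have htH : t.card ≤ Nat.card H := by
        have hsub : t.image (fun d => d - b) ⊆ (Finset.univ.filter (· ∈ H)) := by
          intro y hy
          obtain ⟨d, hd, rfl⟩ := Finset.mem_image.mp hy
          rw [Finset.mem_filter, hH, AddAction.mem_stabilizer_iff]
          refine ⟨Finset.mem_univ _, Finset.eq_of_subset_of_card_le ?_ ?_⟩
          · intro z hz
            obtain ⟨a, ha, rfl⟩ := Finset.mem_vadd_finset.mp hz
            have := h a ha b hb d hd
            rwa [vadd_eq_add, show d - b + a = a - b + d by abel]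
          · rw [Finset.card_vadd_finset]
        have := Finset.card_le_card hsub
        rw [Finset.card_image_of_injective _ sub_left_injective] at this
        rwa [Nat.card_eq_fintype_card, Fintype.card_subtype]
      have := hN H hHtop
      have : s.card ≤ (s + t).card := Finset.card_le_card_add_right ⟨b, hb⟩
      omega

theorem sum_card_add_le_card_sum {N : ℕ} (hN : ∀ H : AddSubgroup G, H ≠ ⊤ → Nat.card H ≤ N)
    {ι : Type*} {I : Finset ι} (hI : I.Nonempty) (f : ι → Finset G)
    (hf : ∀ i ∈ I, (f i).Nonempty) (hu : ∑ i ∈ I, f i ≠ Finset.univ) :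
    ∑ i ∈ I, (f i).card + N ≤ (∑ i ∈ I, f i).card + I.card * N := by
  classical
  induction hI using Finset.Nonempty.cons_induction with
  | singleton a => simp
  | cons a I ha hI ih =>
    rw [Finset.sum_cons] at hu ⊢
    rw [Finset.sum_cons, Finset.card_cons]
    have hfa := hf a (Finset.mem_cons_self a I)
    have hfI : ∀ i ∈ I, (f i).Nonempty := fun i hi => hf i (Finset.mem_cons_of_mem hi)
    have hu' : ∑ i ∈ I, f i ≠ Finset.univ := by
      intro h
      obtain ⟨y, hy⟩ := hfa
      refine hu (Finset.eq_univ_of_forall fun z => ?_)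
      rw [h]
      exact Finset.mem_add.mpr ⟨y, hy, z - y, Finset.mem_univ _, by abel⟩
    have hne : (∑ i ∈ I, f i).Nonempty := by
      choose! g hg using hfI
      refine ⟨∑ i ∈ I, g i, ?_⟩
      rw [← Finset.mem_coe, Finset.coe_sum]
      exact Set.finsetSum_mem_finsetSum _ _ _ fun i hi => hg i hi
    have h1 := ih hfI hu'
    have h2 := card_add_card_le_card_add hN hfa hne hu
    linarith

theorem card_add_card_le_of_zero_notMem_add {s t : Finset G} (h : (0 : G) ∉ s + t) :
    s.card + t.card ≤ Fintype.card G := by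
  have hd : Disjoint (-s) t := by
    rw [Finset.disjoint_left]
    intro x hx hxt
    exact h (Finset.mem_add.mpr ⟨-x, Finset.mem_neg'.mp hx, x, hxt, by simp⟩)
  rw [← Finset.card_neg s, ← Finset.card_union_of_disjoint hd]
  exact Finset.card_le_univ _

theorem sum_card_le_of_zero_notMem_sum {N : ℕ}
    (hN : ∀ H : AddSubgroup G, H ≠ ⊤ → Nat.card H ≤ N)
    {ι : Type*} [Fintype ι] (hι : 2 ≤ Fintype.card ι) (f : ι → Finset G)
    (hf : ∀ i, (f i).Nonempty) (h0 : (0 : G) ∉ ∑ i, f i) :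
    ∑ i, (f i).card + 2 * N ≤ Fintype.card G + Fintype.card ι * N := by
  classical
  obtain ⟨a⟩ : Nonempty ι := Fintype.card_pos_iff.mp (by omega)
  have hcard : (Finset.univ.erase a).card + 1 = Fintype.card ι :=
    Finset.card_erase_add_one (Finset.mem_univ a)
  have hI : (Finset.univ.erase a).Nonempty := Finset.card_pos.mp (by omega)
  rw [← Finset.add_sum_erase _ _ (Finset.mem_univ a)] at h0
  have hu : ∑ i ∈ Finset.univ.erase a, f i ≠ Finset.univ := by
    intro h
    obtain ⟨y, hy⟩ := hf a
    exact h0 (h ▸ Finset.mem_add.mpr ⟨y, hy, -y, Finset.mem_univ _, by simp⟩)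
  have h1 := sum_card_add_le_card_sum hN hI f (fun i _ => hf i) hu
  have h2 := card_add_card_le_of_zero_notMem_add h0
  rw [← Finset.add_sum_erase _ _ (Finset.mem_univ a), ← hcard]
  linarith

end Sumsets

section SignImage

variable {G : Type*} [AddCommGroup G] [DecidableEq G]

/-- The set `s` or `-s`, according to the sign `e`. -/
def signImage (e : ℤˣ) (s : Finset G) : Finset G :=
  s.image (e • ·)

theorem card_signImage (e : ℤˣ) (s : Finset G) : (signImage e s).card = s.card :=
  Finset.card_image_of_injective _ (MulAction.injective e)

theorem Finset.Nonempty.signImage (e : ℤˣ) {s : Finset G} (hs : s.Nonempty) :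
    (signImage e s).Nonempty :=
  hs.image _

theorem mem_signImage {e : ℤˣ} {s : Finset G} {x : G} :
    x ∈ signImage e s ↔ ∃ y ∈ s, e • y = x :=
  Finset.mem_image

theorem signImage_one (s : Finset G) : signImage 1 s = s := by
  simp [signImage]

theorem signImage_neg_one (s : Finset G) : signImage (-1) s = -s := by
  simp [signImage, Units.neg_smul, Finset.image_neg_eq_neg]

theorem zero_mem_sum_signImage {ι : Type*} [Fintype ι] {e : ι → ℤˣ} {f : ι → Finset G}
    (h : (0 : G) ∈ ∑ q, signImage (e q) (f q)) :
    ∃ y : ι → G, (∀ q, y q ∈ f q) ∧ ∑ q, e q • y q = 0 := by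
  rw [← Finset.mem_coe, Finset.coe_sum, Set.mem_finsetSum] at h
  obtain ⟨g, hg, hg0⟩ := h
  choose y hy hyg using fun q => mem_signImage.mp (Finset.mem_coe.mp (hg (Finset.mem_univ q)))
  exact ⟨y, hy, by simpa only [hyg] using hg0⟩

end SignImage

theorem odd_card_of_neg_eq {p : ℕ} [Fact p.Prime] (hp : p ≠ 2) {s : Finset (ZMod p)}
    (h0 : 0 ∈ s) (hs : -s = s) : Odd s.card := by
  rw [← Finset.card_erase_add_one h0]
  refine Even.add_one ?_
  rw [← ZMod.natCast_eq_zero_iff_even, Finset.card_eq_sum_ones, Nat.cast_sum]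
  refine Finset.sum_involution (fun a _ => -a) ?_ ?_ ?_ ?_
  · intro a _
    decide
  · intro a ha _ hneg
    have : Fact (2 < p) := ⟨lt_of_le_of_ne (Fact.out : p.Prime).two_le hp.symm⟩
    exact (Finset.mem_erase.mp ha).1 (ZMod.neg_eq_self_iff a |>.mp hneg |>.resolve_right (by
      intro h
      have := (Fact.out : p.Prime).eq_one_or_self_of_dvd 2 ⟨a.val, h.symm⟩
      omega))
  · intro a ha
    rw [Finset.mem_erase] at ha ⊢
    refine ⟨neg_ne_zero.mpr ha.1, ?_⟩
    rw [← hs]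
    exact Finset.neg_mem_neg ha.2
  · intro a _
    exact neg_neg a

theorem ZMod.card_le_one_of_ne_top {p : ℕ} [Fact p.Prime] (H : AddSubgroup (ZMod p))
    (hH : H ≠ ⊤) : Nat.card H ≤ 1 := by
  have : Fact (Nat.card (ZMod p)).Prime := by rw [Nat.card_zmod]; infer_instance
  rcases H.eq_bot_or_eq_top_of_prime_card with h | h
  · rw [h]; simp
  · exact absurd h hH

/-- For a chain `B` with `|B q| = q`, some reassignment `σ` of the indices `t` to the signs `ε`
gives signed sums of the sets `B (t (σ i))` which represent `0`. -/
theorem exists_perm_sum_eq_zero {p : ℕ} [Fact p.Prime] (hp : p ≠ 2)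
    (B : ℕ → Finset (ZMod p)) (hBmono : Monotone B)
    {ι : Type*} [Fintype ι] [DecidableEq ι] (hι : 3 ≤ Fintype.card ι)
    (ε : ι → ℤˣ) (t : ι → ℕ) (ht : ∀ i, 1 ≤ t i) (hBcard : ∀ i, (B (t i)).card = t i)
    (hsum : p + Fintype.card ι ≤ ∑ i, t i + 2)
    {i j : ι} (hi : ε i = 1) (hj : ε j = -1) (hodd : Odd (t i + t j)) :
    ∃ (σ : Equiv.Perm ι) (x : ι → ZMod p),
      (∀ q, x q ∈ B (t (σ q))) ∧ ∑ q, ε q • x q = 0 := by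
  by_contra hcon
  have hne : ∀ i, (B (t i)).Nonempty := fun i =>
    Finset.card_pos.mp (by rw [hBcard]; exact ht i)
  have hij : i ≠ j := by
    rintro rfl
    rw [hi] at hj
    exact absurd hj (by decide)
  have h0 : ∀ σ : Equiv.Perm ι, (0 : ZMod p) ∉ ∑ q, signImage (ε q) (B (t (σ q))) := by
    intro σ hmem
    obtain ⟨y, hy, hy0⟩ := zero_mem_sum_signImage hmem
    exact hcon ⟨σ, y, hy, hy0⟩
  set J : Finset ι := (Finset.univ.erase i).erase j with hJ
  have hjmem : j ∈ Finset.univ.erase i := Finset.mem_erase.mpr ⟨hij.symm, Finset.mem_univ _⟩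
  have hJcard : J.card + 2 = Fintype.card ι := by
    have h1 := Finset.card_erase_add_one hjmem
    have h2 := Finset.card_erase_add_one (Finset.mem_univ i)
    rw [Finset.card_univ] at h2
    rw [← hJ] at h1
    omega
  have hJne : J.Nonempty := Finset.card_pos.mp (by omega)
  have hsplit : ∀ {M : Type} [AddCommMonoid M] (f : ι → M),
      ∑ q, f q = f i + (f j + ∑ q ∈ J, f q) := fun f => by
    rw [hJ, Finset.add_sum_erase _ _ hjmem, Finset.add_sum_erase _ _ (Finset.mem_univ i)]
  set X := B (t i) with hX
  set Y := B (t j) with hY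
  set W := ∑ q ∈ J, signImage (ε q) (B (t q)) with hW
  have hXY : (0 : ZMod p) ∉ (X - Y) + W := by
    have := h0 1
    rw [hsplit, hi, hj, signImage_one, signImage_neg_one] at this
    simpa [sub_eq_add_neg, add_assoc] using this
  have hYX : (0 : ZMod p) ∉ (Y - X) + W := by
    have := h0 (Equiv.swap i j)
    rw [hsplit, hi, hj, Equiv.swap_apply_left, Equiv.swap_apply_right,
      signImage_one, signImage_neg_one] at this
    have hJs : ∑ q ∈ J, signImage (ε q) (B (t (Equiv.swap i j q))) = W := by
      refine Finset.sum_congr rfl fun q hq => ?_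
      rw [hJ, Finset.mem_erase, Finset.mem_erase] at hq
      rw [Equiv.swap_apply_of_ne_of_ne hq.2.1 hq.1]
    rw [hJs] at this
    simpa [sub_eq_add_neg, add_assoc] using this
  set D := X - Y with hD
  have hDneg : Y - X = -D := by rw [hD, neg_sub]
  have hDne : D.Nonempty := (hne i).sub (hne j)
  have hWne : W.Nonempty := by
    choose g hg using hne
    refine ⟨∑ q ∈ J, ε q • g q, ?_⟩
    rw [hW, ← Finset.mem_coe, Finset.coe_sum]
    exact Set.finsetSum_mem_finsetSum _ _ _ fun q _ =>
      Finset.mem_coe.mpr (mem_signImage.mpr ⟨g q, hg q, rfl⟩)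
  have hE : (0 : ZMod p) ∉ (D ∪ -D) + W := by
    rw [Finset.union_add, Finset.mem_union, ← hDneg]
    exact not_or.mpr ⟨hXY, hYX⟩
  have huniv : ∀ s t : Finset (ZMod p), s.Nonempty → t.Nonempty → (0 : ZMod p) ∉ s + t →
      s ≠ Finset.univ := by
    rintro s t - ⟨y, hy⟩ h rfl
    exact h (Finset.mem_add.mpr ⟨-y, Finset.mem_univ _, y, hy, by simp⟩)
  have hDcard : X.card + Y.card ≤ D.card + 1 := by
    have hDu := huniv D W hDne hWne hXY
    rw [hD, sub_eq_add_neg] at hDu ⊢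
    have := card_add_card_le_card_add ZMod.card_le_one_of_ne_top (hne i) (hne j).neg hDu
    rwa [Finset.card_neg] at this
  have hWcard : ∑ q ∈ J, t q + 1 ≤ W.card + J.card := by
    have := sum_card_add_le_card_sum ZMod.card_le_one_of_ne_top hJne
      (fun q => signImage (ε q) (B (t q))) (fun q _ => (hne q).signImage _)
      (huniv W D hWne hDne (by rwa [add_comm]))
    simpa [card_signImage, hBcard] using this
  have hEW := card_add_card_le_of_zero_notMem_add hE
  rw [ZMod.card] at hEW
  have hDE : D.card ≤ (D ∪ -D).card := Finset.card_le_card Finset.subset_union_left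
  have hoddE : Odd (D ∪ -D).card := by
    refine odd_card_of_neg_eq hp (Finset.mem_union_left _ ?_) ?_
    · rw [hD]
      rcases le_total (t i) (t j) with h | h
      · obtain ⟨y, hy⟩ := hne i
        exact Finset.mem_sub.mpr ⟨y, hy, y, hBmono h hy, sub_self y⟩
      · obtain ⟨y, hy⟩ := hne j
        exact Finset.mem_sub.mpr ⟨y, hBmono h hy, y, hy, sub_self y⟩
    · ext y
      simp [or_comm]
  have hsum' := hsplit t
  rw [hX, hY, hBcard, hBcard] at hDcard
  rw [Nat.odd_iff] at hodd hoddE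
  omega

theorem sum_mem_itSum {G : Type*} [AddCommMonoid G] {A : Set G} {h : ℕ} (a : Fin h → G)
    (ha : ∀ i, a i ∈ A) : ∑ i, a i ∈ itSum h A := by
  induction h with
  | zero => simp [itSum]
  | succ h ih =>
    rw [Fin.sum_univ_castSucc]
    exact Set.add_mem_add (ih _ fun i => ha _) (ha _)

theorem layerKL_nonempty_of_le_weight {p n : ℕ} [NeZero p] {A : Set (Fin n → ZMod p)}
    {v : Fin n → ZMod p} {K : Submodule (ZMod p) (Fin n → ZMod p)}
    {b : ℕ → ZMod p} (hb : Set.BijOn b (Set.Icc 1 p) Set.univ)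
    (hmono : ∀ i j : ℕ, 1 ≤ i → i ≤ j → j ≤ p →
      (layerKL v K A (b j)).ncard ≤ (layerKL v K A (b i)).ncard)
    {t : ℕ} (ht : 1 ≤ t) (htw : t ≤ weight v K A) : (layerKL v K A (b t)).Nonempty := by
  by_contra hempty
  rw [Set.not_nonempty_iff_eq_empty] at hempty
  have hsub : supp v K A ⊆ b '' Set.Icc 1 (t - 1) := by
    intro y hy
    obtain ⟨q, hq, rfl⟩ := hb.surjOn (Set.mem_univ y)
    refine ⟨q, ⟨hq.1, ?_⟩, rfl⟩
    by_contra hqt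
    have := hmono t q ht (by omega) hq.2
    rw [hempty, Set.ncard_empty, Nat.le_zero, Set.ncard_eq_zero (Set.toFinite _)] at this
    exact hy.ne_empty this
  have h1 := Set.ncard_le_ncard hsub (Set.toFinite _)
  have h2 := Set.ncard_image_le (f := b) (Set.finite_Icc 1 (t - 1))
  have h3 : (Set.Icc 1 (t - 1)).ncard = t - 1 := by
    rw [← Finset.coe_Icc, Set.ncard_coe_finset, Nat.card_Icc]
    omega
  unfold weight at htw
  omega

/-- If `ω(A) ≥ m+2`, indices `r_1,…,r_k,s_1,…,s_ℓ ∈ {m-1,…,ω}` include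
both the values `m-1` and `m`, and `Σr_i + Σs_j ≥ p+k+ℓ-2`, then
`Σ|A_{b_{r_i}}| + Σ|A_{b_{s_j}}| ≤ (p+k+ℓ-2)·p^(n-2)`. -/
theorem stmt13 (k l n m lam p : ℕ) (hlk : l < k) (hl : 1 ≤ l) (hn : 2 ≤ n) (hm : 4 ≤ m)
    (hlam : lam ≤ k + l - 3) (hp : p = (k + l) * m + 2 + lam) (hpp : p.Prime)
    (A : Set (Fin n → ZMod p)) (hA : A.Nonempty) (hfree : KLFree k l A)
    (v : Fin n → ZMod p) (K : Submodule (ZMod p) (Fin n → ZMod p))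
    (hK : Module.finrank (ZMod p) K = n - 1) (hv : v ∉ K)
    (b : ℕ → ZMod p) (hb : Set.BijOn b (Set.Icc 1 p) Set.univ)
    (hmono : ∀ i j : ℕ, 1 ≤ i → i ≤ j → j ≤ p →
      (layerKL v K A (b j)).ncard ≤ (layerKL v K A (b i)).ncard)
    (hw : m + 2 ≤ weight v K A)
    (r : Fin k → ℕ) (s : Fin l → ℕ)
    (hr : ∀ i, m - 1 ≤ r i ∧ r i ≤ weight v K A)
    (hs : ∀ j, m - 1 ≤ s j ∧ s j ≤ weight v K A)
    (hocc1 : (∃ i, r i = m - 1) ∨ (∃ j, s j = m - 1))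
    (hocc2 : (∃ i, r i = m) ∨ (∃ j, s j = m))
    (hsum : p + k + l - 2 ≤ (∑ i, r i) + (∑ j, s j)) :
    (∑ i, (layerKL v K A (b (r i))).ncard) + (∑ j, (layerKL v K A (b (s j))).ncard) ≤
      (p + k + l - 2) * p ^ (n - 2) := by
  classical
  have : Fact p.Prime := ⟨hpp⟩
  have hmul : (k + l) * 4 ≤ (k + l) * m := Nat.mul_le_mul_left _ hm
  have hwp : weight v K A ≤ p := by
    have := Set.ncard_le_ncard (Set.subset_univ (supp v K A))
    rwa [Set.ncard_univ, Nat.card_zmod] at this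
  let ε : Fin k ⊕ Fin l → ℤˣ := Sum.elim (fun _ => 1) (fun _ => -1)
  let t : Fin k ⊕ Fin l → ℕ := Sum.elim r s
  have htm : ∀ q, m - 1 ≤ t q ∧ t q ≤ weight v K A := by rintro (i | j); exacts [hr i, hs j]
  obtain ⟨i, j, hodd⟩ : ∃ i j, Odd (r i + s j) := by
    simp only [Nat.odd_iff]
    rcases hocc1 with ⟨i, hi⟩ | ⟨j, hj⟩ <;> rcases hocc2 with ⟨i', hi'⟩ | ⟨j', hj'⟩
    · rcases Nat.mod_two_eq_zero_or_one (r i + s ⟨0, hl⟩) with h | h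
      · exact ⟨i', ⟨0, hl⟩, by omega⟩
      · exact ⟨i, ⟨0, hl⟩, h⟩
    · exact ⟨i, j', by omega⟩
    · exact ⟨i', j, by omega⟩
    · rcases Nat.mod_two_eq_zero_or_one (r ⟨0, by omega⟩ + s j) with h | h
      · exact ⟨⟨0, by omega⟩, j', by omega⟩
      · exact ⟨⟨0, by omega⟩, j, h⟩
  clear hocc1 hocc2
  have hcard : Fintype.card (Fin k ⊕ Fin l) = k + l := by simp
  have hinj : ∀ q ≤ p, ((Finset.Icc 1 q).image b).card = q := fun q hq => by
    rw [Finset.card_image_of_injOn, Nat.card_Icc, Nat.add_sub_cancel]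
    rw [Finset.coe_Icc]
    exact hb.injOn.mono (Set.Icc_subset_Icc_right hq)
  obtain ⟨σ, x, hx, hx0⟩ := exists_perm_sum_eq_zero (by omega)
    (fun q => (Finset.Icc 1 q).image b)
    (fun _ _ h => Finset.image_subset_image (Finset.Icc_subset_Icc_right h))
    (by omega) ε t (fun q => by have := htm q; omega)
    (fun q => hinj _ ((htm q).2.trans hwp))
    (by rw [Fintype.sum_sum_type, hcard]; simp only [t, Sum.elim_inl, Sum.elim_inr]; omega)
    (i := Sum.inl i) (j := Sum.inr j) rfl rfl hodd
  let L : ZMod p → Finset K := fun c => Finset.univ.filter fun y => (y : Fin n → ZMod p) + c • v ∈ A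
  have hL : ∀ c, (L c).card = (layerKL v K A c).ncard := fun c => by
    have : layerKL v K A c = Subtype.val '' (L c : Set K) := by
      ext y
      simp [layerKL, L, and_comm]
    rw [this, Set.ncard_image_of_injective _ Subtype.val_injective, Set.ncard_coe_finset]
  have hge : ∀ q, (layerKL v K A (b (t (σ q)))).ncard ≤ (L (x q)).card := fun q => by
    obtain ⟨c, hc, hcx⟩ := Finset.mem_image.mp (hx q)
    rw [Finset.mem_Icc] at hc
    rw [hL, ← hcx]
    exact hmono c _ hc.1 hc.2 ((htm _).2.trans hwp)
  have hLne : ∀ q, (L (x q)).Nonempty := fun q => by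
    refine Finset.card_pos.mp (lt_of_lt_of_le ?_ (hge q))
    rw [Set.ncard_pos (Set.toFinite _)]
    have := htm (σ q)
    exact layerKL_nonempty_of_le_weight hb hmono (by omega) this.2
  have h0 : (0 : K) ∉ ∑ q, signImage (ε q) (L (x q)) := by
    intro hmem
    obtain ⟨y, hy, hy0⟩ := zero_mem_sum_signImage hmem
    have hyA : ∀ q, (y q : Fin n → ZMod p) + x q • v ∈ A := fun q =>
      (Finset.mem_filter.mp (hy q)).2
    have hzero : ∑ q, ε q • ((y q : Fin n → ZMod p) + x q • v) = 0 := by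
      have h1 : ∑ q, ε q • (y q : Fin n → ZMod p) = 0 := by
        have := congrArg (Subtype.val : K → Fin n → ZMod p) hy0
        simpa [Units.smul_def] using this
      have h2 : ∑ q, ε q • (x q • v) = 0 := by
        have := congrArg (· • v) hx0
        simp only [Finset.sum_smul, zero_smul] at this
        simpa only [smul_assoc] using this
      simp only [smul_add, Finset.sum_add_distrib, h1, h2, add_zero]
    rw [Fintype.sum_sum_type] at hzero
    simp only [ε, Sum.elim_inl, Sum.elim_inr, one_smul, Units.neg_smul, Finset.sum_neg_distrib,
      add_neg_eq_zero] at hzero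
    have hk := sum_mem_itSum _ fun i => hyA (Sum.inl i)
    have hl' := sum_mem_itSum _ fun j => hyA (Sum.inr j)
    rw [← hzero] at hl'
    exact Set.disjoint_left.mp (Set.disjoint_iff_inter_eq_empty.mpr hfree) hk hl'
  have hKcard : Fintype.card K = p ^ (n - 1) := by
    rw [Module.card_eq_pow_finrank (K := ZMod p), ZMod.card, hK]
  have hN : ∀ H : AddSubgroup K, H ≠ ⊤ → Nat.card H ≤ p ^ (n - 2) := fun H hH => by
    have hdvd := H.card_addSubgroup_dvd_card
    rw [Nat.card_eq_fintype_card (α := K), hKcard, Nat.dvd_prime_pow hpp] at hdvd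
    obtain ⟨e, he, hHe⟩ := hdvd
    rw [hHe]
    refine Nat.pow_le_pow_right hpp.pos ?_
    by_contra hlt
    have hen : e = n - 1 := by omega
    refine hH (AddSubgroup.eq_top_of_card_eq _ ?_)
    rw [hHe, Nat.card_eq_fintype_card, hKcard, hen]
  have hmain := sum_card_le_of_zero_notMem_sum hN (by omega) (fun q => signImage (ε q) (L (x q)))
    (fun q => (hLne q).signImage _) h0
  simp only [card_signImage] at hmain
  have hle : ∑ q, (layerKL v K A (b (t q))).ncard ≤ ∑ q, (L (x q)).card := by
    rw [← Equiv.sum_comp σ]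
    exact Finset.sum_le_sum fun q _ => hge q
  rw [Fintype.sum_sum_type] at hle
  simp only [t, Sum.elim_inl, Sum.elim_inr] at hle
  rw [hKcard, hcard, show n - 1 = n - 2 + 1 by omega, pow_succ] at hmain
  obtain ⟨c, hc⟩ : ∃ c, p + k + l = c + 2 := ⟨p + k + l - 2, by omega⟩
  rw [show p + k + l - 2 = c by omega]
  have hexp : p ^ (n - 2) * p + (k + l) * p ^ (n - 2) = c * p ^ (n - 2) + 2 * p ^ (n - 2) := by
    rw [← add_mul, ← hc]
    ring
  omega
end
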